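/- There exists an unsatisfiable linear 3-CNF formula with exactly 30 clauses. -/

import Mathlib

/-- A clause: a finite set of literals, where a literal is a pair of a variable
and a sign (`true` = positive occurrence, `false` = negated occurrence). -/
abbrev Clause (V : Type) : Type := Finset (V × Bool)

/-- A CNF formula: a finite set of clauses. -/
abbrev CNF (V : Type) : Type := Finset (Finset (V × Bool))

/-- The set of variables occurring (possibly negated) in a clause. -/
def vbl {V : Type} [DecidableEq V] (C : Clause V) : Finset V := C.image Prod.fst

/-- A clause is proper if it does not contain both a variable and its negation. -/
def ProperClause {V : Type} (C : Clause V) : Prop :=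
  ∀ x : V, ¬ ((x, true) ∈ C ∧ (x, false) ∈ C)

/-- The literal `(x, b)` evaluates to true under `α` iff `α x = b`;
an assignment satisfies a clause if some literal evaluates to true. -/
def SatClause {V : Type} (α : V → Bool) (C : Clause V) : Prop :=
  ∃ l ∈ C, α l.1 = l.2

instance {V : Type} [DecidableEq V] (α : V → Bool) (C : Clause V) :
    Decidable (SatClause α C) := by unfold SatClause; infer_instance

/-- An assignment satisfies a formula if it satisfies every clause. -/
def Satisfies {V : Type} (α : V → Bool) (F : CNF V) : Prop :=
  ∀ C ∈ F, SatClause α C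

/-- A formula is unsatisfiable if no assignment satisfies it. -/
def Unsat {V : Type} (F : CNF V) : Prop := ∀ α : V → Bool, ¬ Satisfies α F

/-- A `k`-CNF: every clause is proper and has exactly `k` literals. -/
def IsKCNF {V : Type} (k : ℕ) (F : CNF V) : Prop :=
  ∀ C ∈ F, ProperClause C ∧ C.card = k

/-- A CNF is linear if any two distinct clauses share at most one variable. -/
def LinearCNF {V : Type} [DecidableEq V] (F : CNF V) : Prop :=
  ∀ C ∈ F, ∀ D ∈ F, C ≠ D → (vbl C ∩ vbl D).card ≤ 1

/-- An unsatisfiable linear formula on the variables `k + 1, …, k + 10` with five pairwise disjoint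
2-clauses and ten 3-clauses, in which each 2-clause is extended by the literal `(0, s)`. -/
def guardedFormula (s : Bool) (k : ℕ) : CNF ℕ :=
  {{(0, s), (k + 3, true), (k + 7, true)},
   {(0, s), (k + 6, true), (k + 8, false)},
   {(0, s), (k + 5, false), (k + 10, false)},
   {(0, s), (k + 4, false), (k + 9, true)},
   {(k + 4, true), (k + 7, false), (k + 8, true)},
   {(k + 1, false), (k + 4, false), (k + 10, true)},
   {(k + 3, false), (k + 8, true), (k + 10, true)},
   {(k + 2, false), (k + 6, false), (k + 10, true)},
   {(k + 2, true), (k + 8, false), (k + 9, true)},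
   {(k + 7, true), (k + 9, true), (k + 10, false)},
   {(k + 5, true), (k + 6, false), (k + 7, false)},
   {(k + 3, false), (k + 5, true), (k + 9, false)},
   {(k + 3, true), (k + 4, false), (k + 6, true)},
   {(k + 1, true), (k + 2, true), (k + 5, false)},
   {(k + 1, false), (k + 6, false), (k + 9, false)}}

lemma guardedFormula_core_unsat : ∀ b1 b2 b3 b4 b5 b6 b7 b8 b9 b10 : Bool,
    ((b3 || b7) && (b6 || !b8) && (!b5 || !b10) && (!b4 || b9) &&
      (b4 || !b7 || b8) && (!b1 || !b4 || b10) && (!b3 || b8 || b10) && (!b2 || !b6 || b10) &&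
      (b2 || !b8 || b9) && (b7 || b9 || !b10) && (b5 || !b6 || !b7) && (!b3 || b5 || !b9) &&
      (b3 || !b4 || b6) && (b1 || b2 || !b5) && (!b1 || !b6 || !b9)) = false := by
  decide +kernel

lemma Satisfies.eq_of_guardedFormula {α : ℕ → Bool} {s : Bool} {k : ℕ}
    (h : Satisfies α (guardedFormula s k)) : α 0 = s := by
  by_contra hs
  have hu := guardedFormula_core_unsat
    (α (k + 1)) (α (k + 2)) (α (k + 3)) (α (k + 4)) (α (k + 5))
    (α (k + 6)) (α (k + 7)) (α (k + 8)) (α (k + 9)) (α (k + 10))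
  simp only [guardedFormula, Satisfies, SatClause, Finset.forall_mem_insert,
    Finset.mem_singleton, forall_eq, Finset.exists_mem_insert, exists_eq_left, hs,
    false_or] at h
  exact Bool.eq_false_iff.1 hu (by simpa [or_assoc, and_assoc] using h)

lemma properClause_iff {V : Type} (C : Clause V) :
    ProperClause C ↔ ∀ l ∈ C, (l.1, !l.2) ∉ C := by
  constructor
  · rintro h ⟨x, _ | _⟩ hx hx'
    · exact h x ⟨hx', hx⟩
    · exact h x ⟨hx, hx'⟩
  · exact fun h x hx => h _ hx.1 hx.2

/-- There exists an unsatisfiable linear 3-CNF formula with exactly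
30 clauses. -/
theorem unsat_linear_3CNF_30_clauses :
    ∃ F : CNF ℕ, IsKCNF 3 F ∧ LinearCNF F ∧ Unsat F ∧ F.card = 30 := by
  refine ⟨guardedFormula true 0 ∪ guardedFormula false 10, ?_, ?_, ?_, ?_⟩
  · simp only [IsKCNF, properClause_iff]
    decide +kernel
  · unfold LinearCNF
    decide +kernel
  · intro α h
    have h₁ := Satisfies.eq_of_guardedFormula fun C hC => h C (Finset.mem_union_left _ hC)
    have h₂ := Satisfies.eq_of_guardedFormula fun C hC => h C (Finset.mem_union_right _ hC)
    exact Bool.noConfusion (h₁.symm.trans h₂)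
  · decide +kernel
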